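/- Uniqueness for the regularized 2-1 junction: for a given set of initial data φ^1, φ^2, φ^3 ∈ B and boundary data f̄^1, f̄^2 : [0,T] → B, Φ̄^3 : [0,T] → [0,1], there is at most one mild kinetic solution across the regularized 2-1 junction; i.e., if F and G are both mild kinetic solutions with the same data, then F(t) = G(t) for all t ∈ [0,T]. -/

import Mathlib

open Set

noncomputable def rhoF {n : ℕ} (f : Fin n → ℝ) : ℝ := ∑ j, f j

noncomputable def fluxF {n : ℕ} (v f : Fin n → ℝ) : ℝ := ∑ j, v j * f j

noncomputable def gainF {n : ℕ} (η0 : ℝ) (A : Fin n → Fin n → Fin n → ℝ → ℝ)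
    (j : Fin n) (f : Fin n → ℝ) : ℝ :=
  η0 * rhoF f * ∑ h, ∑ k, A h k j (rhoF f) * f h * f k

noncomputable def lossF {n : ℕ} (η0 : ℝ) (f : Fin n → ℝ) : ℝ := η0 * (rhoF f) ^ 2

def admissibleF {n : ℕ} (f : Fin n → ℝ) : Prop :=
  (∀ j, 0 ≤ f j ∧ f j ≤ 1) ∧ rhoF f ≤ 1

noncomputable def deltaC {n : ℕ} (j : Fin n) : ℝ := if (j : ℕ) = 0 then 0 else 1

def IsSpeedLattice {n : ℕ} (hn : 2 ≤ n) (v : Fin n → ℝ) : Prop :=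
  StrictMono v ∧ v ⟨0, by omega⟩ = 0 ∧ v ⟨n - 1, by omega⟩ = 1

def IsFluxLimiter (Φ : ℝ → ℝ → ℝ) : Prop :=
  (∀ u ∈ Icc (0:ℝ) 1, ∀ w ∈ Icc (0:ℝ) 1, Φ u w ∈ Icc (0:ℝ) 1) ∧
  (∀ u ∈ Icc (0:ℝ) 1, ∀ w ∈ Icc (0:ℝ) 1, 1 < u + w → Φ u w * u ≤ 1 - w) ∧
  (∃ K : ℝ, 0 < K ∧ ∀ u₁ ∈ Icc (0:ℝ) 1, ∀ w₁ ∈ Icc (0:ℝ) 1, ∀ u₂ ∈ Icc (0:ℝ) 1,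
    ∀ w₂ ∈ Icc (0:ℝ) 1, |Φ u₂ w₂ - Φ u₁ w₁| ≤ K * (|u₂ - u₁| + |w₂ - w₁|))

def IsTableOfGames {n : ℕ} (A : Fin n → Fin n → Fin n → ℝ → ℝ) : Prop :=
  (∀ h k j : Fin n, ∀ u ∈ Icc (0:ℝ) 1, A h k j u ∈ Icc (0:ℝ) 1) ∧
  (∀ h k : Fin n, ∀ u ∈ Icc (0:ℝ) 1, ∑ j, A h k j u = 1) ∧
  (∀ h k j : Fin n, ∃ K : ℝ, 0 < K ∧ ∀ u ∈ Icc (0:ℝ) 1, ∀ w ∈ Icc (0:ℝ) 1,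
    |A h k j u - A h k j w| ≤ K * |u - w|)

def IsRegularizer (ε : ℝ) (H : ℝ → ℝ) : Prop :=
  (∀ x : ℝ, H x ∈ Icc (0:ℝ) 1) ∧ (∀ x : ℝ, x ≤ 0 → H x = 0) ∧ (∀ x : ℝ, ε ≤ x → H x = 1) ∧
  ∃ K : ℝ, 0 < K ∧ ∀ x y : ℝ, |H x - H y| ≤ K * |x - y|

noncomputable def hcoef {n : ℕ} (v : Fin n → ℝ) (H : ℝ → ℝ) (p : ℝ)
    (f1 f2 : ℝ → Fin n → ℝ) (s : ℝ) : ℝ :=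
  H (p - (fluxF v (f1 s) + fluxF v (f2 s)))

noncomputable def phi301 {n : ℕ} (v : Fin n → ℝ) (Φ : ℝ → ℝ → ℝ) (H : ℝ → ℝ) (p : ℝ)
    (f1 f2 f3 : ℝ → Fin n → ℝ) (s : ℝ) : ℝ :=
  Φ (∑ k, deltaC k * (f1 s k + hcoef v H p f1 f2 s * f2 s k)) (rhoF (f3 s))

noncomputable def rhs21_1 {n : ℕ} (v : Fin n → ℝ) (η0 : ℝ) (A : Fin n → Fin n → Fin n → ℝ → ℝ)
    (Φ : ℝ → ℝ → ℝ) (H : ℝ → ℝ) (p : ℝ) (fbar1 f1 f2 f3 : ℝ → Fin n → ℝ)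
    (j : Fin n) (s : ℝ) : ℝ :=
  v j * (Φ (∑ k, fbar1 s k) (rhoF (f1 s)) * fbar1 s j - phi301 v Φ H p f1 f2 f3 s * f1 s j)
  + gainF η0 A j (f1 s) - f1 s j * lossF η0 (f1 s)

noncomputable def rhs21_2 {n : ℕ} (v : Fin n → ℝ) (η0 : ℝ) (A : Fin n → Fin n → Fin n → ℝ → ℝ)
    (Φ : ℝ → ℝ → ℝ) (H : ℝ → ℝ) (p : ℝ) (fbar2 f1 f2 f3 : ℝ → Fin n → ℝ)
    (j : Fin n) (s : ℝ) : ℝ :=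
  v j * (Φ (∑ k, fbar2 s k) (rhoF (f2 s)) * fbar2 s j
    - hcoef v H p f1 f2 s * phi301 v Φ H p f1 f2 f3 s * f2 s j)
  + gainF η0 A j (f2 s) - f2 s j * lossF η0 (f2 s)

noncomputable def rhs21_3 {n : ℕ} (v : Fin n → ℝ) (η0 : ℝ) (A : Fin n → Fin n → Fin n → ℝ → ℝ)
    (Φ : ℝ → ℝ → ℝ) (H : ℝ → ℝ) (p : ℝ) (Φbar3 : ℝ → ℝ) (f1 f2 f3 : ℝ → Fin n → ℝ)
    (j : Fin n) (s : ℝ) : ℝ :=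
  v j * (phi301 v Φ H p f1 f2 f3 s * (f1 s j + hcoef v H p f1 f2 s * f2 s j) * deltaC j
    - Φbar3 s * f3 s j)
  + gainF η0 A j (f3 s) - f3 s j * lossF η0 (f3 s)

def IsMildSol21 {n : ℕ} (v : Fin n → ℝ) (η0 : ℝ) (A : Fin n → Fin n → Fin n → ℝ → ℝ)
    (Φ : ℝ → ℝ → ℝ) (H : ℝ → ℝ) (p T : ℝ) (φ1 φ2 φ3 : Fin n → ℝ)
    (fbar1 fbar2 : ℝ → Fin n → ℝ) (Φbar3 : ℝ → ℝ) (f1 f2 f3 : ℝ → Fin n → ℝ) : Prop :=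
  ContinuousOn f1 (Icc 0 T) ∧ ContinuousOn f2 (Icc 0 T) ∧ ContinuousOn f3 (Icc 0 T) ∧
  (∀ t ∈ Icc (0:ℝ) T, admissibleF (f1 t) ∧ admissibleF (f2 t) ∧ admissibleF (f3 t)) ∧
  (∀ t ∈ Icc (0:ℝ) T, ∀ j : Fin n,
    f1 t j = φ1 j + ∫ s in (0:ℝ)..t, rhs21_1 v η0 A Φ H p fbar1 f1 f2 f3 j s) ∧
  (∀ t ∈ Icc (0:ℝ) T, ∀ j : Fin n,
    f2 t j = φ2 j + ∫ s in (0:ℝ)..t, rhs21_2 v η0 A Φ H p fbar2 f1 f2 f3 j s) ∧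
  (∀ t ∈ Icc (0:ℝ) T, ∀ j : Fin n,
    f3 t j = φ3 j + ∫ s in (0:ℝ)..t, rhs21_3 v η0 A Φ H p Φbar3 f1 f2 f3 j s)

def GoodData21 {n : ℕ} (T : ℝ) (φ1 φ2 φ3 : Fin n → ℝ) (fbar1 fbar2 : ℝ → Fin n → ℝ)
    (Φbar3 : ℝ → ℝ) : Prop :=
  admissibleF φ1 ∧ admissibleF φ2 ∧ admissibleF φ3 ∧
  ContinuousOn fbar1 (Icc 0 T) ∧ (∀ t ∈ Icc (0:ℝ) T, admissibleF (fbar1 t)) ∧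
  ContinuousOn fbar2 (Icc 0 T) ∧ (∀ t ∈ Icc (0:ℝ) T, admissibleF (fbar2 t)) ∧
  ContinuousOn Φbar3 (Icc 0 T) ∧ (∀ t ∈ Icc (0:ℝ) T, Φbar3 t ∈ Icc (0:ℝ) 1)

/-- A time-dependent real field `g : ℝ → E → ℝ` that, for times in `I` and states in `S`, is
continuous in time, uniformly bounded, and Lipschitz in the state uniformly in time. -/
structure UniformBddLipOn {E : Type*} [PseudoMetricSpace E] (I : Set ℝ) (S : Set E)
    (g : ℝ → E → ℝ) : Prop where
  continuousOn : ∀ x ∈ S, ContinuousOn (fun s => g s x) I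
  bounded : ∃ M : ℝ, 0 ≤ M ∧ ∀ s ∈ I, ∀ x ∈ S, |g s x| ≤ M
  lipschitz : ∃ K : ℝ, 0 ≤ K ∧ ∀ s ∈ I, ∀ x ∈ S, ∀ y ∈ S, |g s x - g s y| ≤ K * dist x y

namespace UniformBddLipOn

variable {E : Type*} [PseudoMetricSpace E] {I : Set ℝ} {S : Set E} {a b : ℝ → E → ℝ}

theorem of_time {c : ℝ → ℝ} (hc : ContinuousOn c I) (hb : ∀ s ∈ I, c s ∈ Icc (0:ℝ) 1) :
    UniformBddLipOn I S (fun s _ => c s) where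
  continuousOn _ _ := hc
  bounded := ⟨1, zero_le_one, fun s hs _ _ =>
    abs_le.2 ⟨by linarith [(hb s hs).1], (hb s hs).2⟩⟩
  lipschitz := ⟨0, le_rfl, by simp⟩

theorem const (c : ℝ) : UniformBddLipOn I S (fun _ _ => c) where
  continuousOn _ _ := continuousOn_const
  bounded := ⟨|c|, abs_nonneg c, fun _ _ _ _ => le_rfl⟩
  lipschitz := ⟨0, le_rfl, by simp⟩

theorem of_state {c : E → ℝ} (hc : LipschitzWith 1 c) (hb : ∀ x ∈ S, c x ∈ Icc (0:ℝ) 1) :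
    UniformBddLipOn I S (fun _ x => c x) where
  continuousOn _ _ := continuousOn_const
  bounded := ⟨1, zero_le_one, fun _ _ x hx =>
    abs_le.2 ⟨by linarith [(hb x hx).1], (hb x hx).2⟩⟩
  lipschitz := ⟨1, zero_le_one, fun _ _ x _ y _ => by
    simpa [Real.dist_eq] using hc.dist_le_mul x y⟩

theorem add (ha : UniformBddLipOn I S a) (hb : UniformBddLipOn I S b) :
    UniformBddLipOn I S (fun s x => a s x + b s x) where
  continuousOn x hx := (ha.continuousOn x hx).add (hb.continuousOn x hx)
  bounded := by
    obtain ⟨M, hM, h⟩ := ha.bounded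
    obtain ⟨N, hN, h'⟩ := hb.bounded
    exact ⟨M + N, by positivity, fun s hs x hx =>
      (abs_add_le _ _).trans (add_le_add (h s hs x hx) (h' s hs x hx))⟩
  lipschitz := by
    obtain ⟨K, hK, h⟩ := ha.lipschitz
    obtain ⟨L, hL, h'⟩ := hb.lipschitz
    refine ⟨K + L, by positivity, fun s hs x hx y hy => ?_⟩
    calc |a s x + b s x - (a s y + b s y)| = |(a s x - a s y) + (b s x - b s y)| := by ring_nf
      _ ≤ |a s x - a s y| + |b s x - b s y| := abs_add_le _ _
      _ ≤ (K + L) * dist x y := by linarith [h s hs x hx y hy, h' s hs x hx y hy]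

theorem mul (ha : UniformBddLipOn I S a) (hb : UniformBddLipOn I S b) :
    UniformBddLipOn I S (fun s x => a s x * b s x) where
  continuousOn x hx := (ha.continuousOn x hx).mul (hb.continuousOn x hx)
  bounded := by
    obtain ⟨M, hM, h⟩ := ha.bounded
    obtain ⟨N, hN, h'⟩ := hb.bounded
    exact ⟨M * N, by positivity, fun s hs x hx => by
      rw [abs_mul]
      exact mul_le_mul (h s hs x hx) (h' s hs x hx) (abs_nonneg _) hM⟩
  lipschitz := by
    obtain ⟨M, hM, hm⟩ := ha.bounded
    obtain ⟨N, hN, hn⟩ := hb.bounded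
    obtain ⟨K, hK, h⟩ := ha.lipschitz
    obtain ⟨L, hL, h'⟩ := hb.lipschitz
    refine ⟨M * L + K * N, by positivity, fun s hs x hx y hy => ?_⟩
    calc |a s x * b s x - a s y * b s y|
        = |a s x * (b s x - b s y) + (a s x - a s y) * b s y| := by ring_nf
      _ ≤ |a s x| * |b s x - b s y| + |a s x - a s y| * |b s y| := by
        rw [← abs_mul, ← abs_mul]; exact abs_add_le _ _
      _ ≤ M * (L * dist x y) + (K * dist x y) * N := by
        gcongr
        exacts [hm s hs x hx, h' s hs x hx y hy, h s hs x hx y hy, hn s hs y hy]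
      _ = (M * L + K * N) * dist x y := by ring

theorem sub (ha : UniformBddLipOn I S a) (hb : UniformBddLipOn I S b) :
    UniformBddLipOn I S (fun s x => a s x - b s x) := by
  simpa [sub_eq_add_neg] using ha.add ((const (-1)).mul hb)

theorem sum {ι : Type*} (J : Finset ι) {g : ι → ℝ → E → ℝ}
    (h : ∀ i, UniformBddLipOn I S (g i)) :
    UniformBddLipOn I S (fun s x => ∑ i ∈ J, g i s x) := by
  classical
  induction J using Finset.induction_on with
  | empty => simpa using const 0
  | insert i J hi ih => simpa [Finset.sum_insert hi] using (h i).add ih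

/-- Composition with a bounded function of two variables that is Lipschitz on a product of sets. -/
theorem comp₂ {ψ : ℝ → ℝ → ℝ} {D D' : Set ℝ} {K : ℝ} (hK : 0 ≤ K)
    (hψ : ∀ u ∈ D, ∀ w ∈ D', ψ u w ∈ Icc (0:ℝ) 1)
    (hlip : ∀ u₁ ∈ D, ∀ w₁ ∈ D', ∀ u₂ ∈ D, ∀ w₂ ∈ D',
      |ψ u₂ w₂ - ψ u₁ w₁| ≤ K * (|u₂ - u₁| + |w₂ - w₁|))
    (ha : UniformBddLipOn I S a) (hb : UniformBddLipOn I S b)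
    (haD : ∀ s ∈ I, ∀ x ∈ S, a s x ∈ D) (hbD : ∀ s ∈ I, ∀ x ∈ S, b s x ∈ D') :
    UniformBddLipOn I S (fun s x => ψ (a s x) (b s x)) where
  continuousOn x hx s hs := by
    have hA := tendsto_iff_dist_tendsto_zero.1 (ha.continuousOn x hx s hs)
    have hB := tendsto_iff_dist_tendsto_zero.1 (hb.continuousOn x hx s hs)
    refine tendsto_iff_dist_tendsto_zero.2 ?_
    have hAB := (hA.add hB).const_mul K
    rw [add_zero, mul_zero] at hAB
    refine squeeze_zero' (Filter.Eventually.of_forall fun _ => dist_nonneg) ?_ hAB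
    filter_upwards [self_mem_nhdsWithin] with r hr
    exact hlip _ (haD s hs x hx) _ (hbD s hs x hx) _ (haD r hr x hx) _ (hbD r hr x hx)
  bounded := ⟨1, zero_le_one, fun s hs x hx => by
    have := hψ _ (haD s hs x hx) _ (hbD s hs x hx)
    exact abs_le.2 ⟨by linarith [this.1], this.2⟩⟩
  lipschitz := by
    obtain ⟨L, hL, h⟩ := ha.lipschitz
    obtain ⟨M, hM, h'⟩ := hb.lipschitz
    refine ⟨K * (L + M), by positivity, fun s hs x hx y hy => ?_⟩
    calc |ψ (a s x) (b s x) - ψ (a s y) (b s y)|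
        ≤ K * (|a s x - a s y| + |b s x - b s y|) :=
          hlip _ (haD s hs y hy) _ (hbD s hs y hy) _ (haD s hs x hx) _ (hbD s hs x hx)
      _ ≤ K * (L * dist x y + M * dist x y) := by
        gcongr
        exacts [h s hs x hx y hy, h' s hs x hx y hy]
      _ = K * (L + M) * dist x y := by ring

theorem comp {ψ : ℝ → ℝ} {D : Set ℝ} {K : ℝ} (hK : 0 ≤ K)
    (hψ : ∀ u ∈ D, ψ u ∈ Icc (0:ℝ) 1)
    (hlip : ∀ u ∈ D, ∀ w ∈ D, |ψ u - ψ w| ≤ K * |u - w|)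
    (ha : UniformBddLipOn I S a) (haD : ∀ s ∈ I, ∀ x ∈ S, a s x ∈ D) :
    UniformBddLipOn I S (fun s x => ψ (a s x)) :=
  comp₂ (ψ := fun u _ => ψ u) (D' := Set.univ) hK (fun u hu _ _ => hψ u hu)
    (fun u₁ h₁ w₁ _ u₂ h₂ w₂ _ => (hlip u₂ h₂ u₁ h₁).trans <| by
      gcongr; linarith [abs_nonneg (w₂ - w₁)]) ha ha haD (fun _ _ _ _ => Set.mem_univ _)

theorem exists_uniform_lipschitz {ι : Type*} [Fintype ι] {g : ι → ℝ → E → ℝ}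
    (h : ∀ i, UniformBddLipOn I S (g i)) :
    ∃ K : ℝ, 0 ≤ K ∧ ∀ i, ∀ s ∈ I, ∀ x ∈ S, ∀ y ∈ S, |g i s x - g i s y| ≤ K * dist x y := by
  choose K hK hlip using fun i => (h i).lipschitz
  refine ⟨∑ i, K i, Finset.sum_nonneg fun i _ => hK i, fun i s hs x hx y hy =>
    (hlip i s hs x hx y hy).trans ?_⟩
  gcongr
  exact Finset.single_le_sum (fun i _ => hK i) (Finset.mem_univ i)

theorem continuousOn_comp_curve (ha : UniformBddLipOn I S a) {γ : ℝ → E} (hγ : ContinuousOn γ I)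
    (hS : ∀ s ∈ I, γ s ∈ S) : ContinuousOn (fun s => a s (γ s)) I := by
  obtain ⟨K, hK, h⟩ := ha.lipschitz
  have hjoint : ContinuousOn (fun q : ℝ × E => a q.1 q.2) (I ×ˢ S) :=
    continuousOn_prod_of_continuousOn_lipschitzOnWith' _ K.toNNReal
      (fun s hs => LipschitzOnWith.of_dist_le_mul fun x hx y hy => by
        rw [Real.coe_toNNReal _ hK]
        exact h s hs x hx y hy)
      ha.continuousOn
  exact hjoint.comp (continuousOn_id.prodMk hγ) fun s hs => ⟨hs, hS s hs⟩

end UniformBddLipOn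

/-- A function equal on `[0, T]` to the primitive of a continuous function has the expected right
derivative on `[0, T)`. -/
theorem hasDerivWithinAt_Ici_of_eq_integral {T c : ℝ} {y r : ℝ → ℝ}
    (hr : ContinuousOn r (Icc 0 T))
    (hy : ∀ t ∈ Icc (0:ℝ) T, y t = c + ∫ s in (0:ℝ)..t, r s) {t : ℝ} (ht : t ∈ Ico 0 T) :
    HasDerivWithinAt y (r t) (Ici t) t := by
  have hT : (0:ℝ) ≤ T := ht.1.trans ht.2.le
  have hr' : Continuous (IccExtend hT ((Icc 0 T).domRestrict r)) :=
    (continuousOn_iff_continuous_domRestrict.1 hr).Icc_extend'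
  have heq : ∀ s ∈ Icc (0:ℝ) T, IccExtend hT ((Icc 0 T).domRestrict r) s = r s := fun s hs => by
    rw [IccExtend_of_mem _ _ hs]; rfl
  have hy' : ∀ u ∈ Icc (0:ℝ) T,
      y u = c + ∫ s in (0:ℝ)..u, IccExtend hT ((Icc 0 T).domRestrict r) s := fun u hu => by
    rw [hy u hu]
    congr 1
    refine intervalIntegral.integral_congr fun s hs => (heq s ?_).symm
    rw [uIcc_of_le hu.1] at hs
    exact ⟨hs.1, hs.2.trans hu.2⟩
  have hd := ((hr'.integral_hasStrictDerivAt 0 t).hasDerivAt.const_add c).hasDerivWithinAt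
    (s := Ici t)
  rw [heq t ⟨ht.1, ht.2.le⟩] at hd
  refine hd.congr_of_eventuallyEq ?_ (hy' t ⟨ht.1, ht.2.le⟩)
  filter_upwards [Icc_mem_nhdsGE ht.2] with u hu
  exact hy' u ⟨ht.1.trans hu.1, hu.2⟩

theorem rhoF_mem_Icc {n : ℕ} {f : Fin n → ℝ} (hf : admissibleF f) : rhoF f ∈ Icc (0:ℝ) 1 :=
  ⟨Finset.sum_nonneg fun j _ => (hf.1 j).1, hf.2⟩

theorem deltaC_nonneg {n : ℕ} (k : Fin n) : 0 ≤ deltaC k := by unfold deltaC; split_ifs <;> simp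

theorem deltaC_le_one {n : ℕ} (k : Fin n) : deltaC k ≤ 1 := by unfold deltaC; split_ifs <;> simp

theorem deltaC_mul_le_speed {n : ℕ} {hn : 2 ≤ n} {v : Fin n → ℝ} (hv : IsSpeedLattice hn v) {p : ℝ}
    {i : Fin n} (hi : (i : ℕ) = 1) (hpv : p ≤ v i) (k : Fin n) : deltaC k * p ≤ v k := by
  unfold deltaC
  split_ifs with h
  · rw [zero_mul, ← hv.2.1]
    exact hv.1.monotone (Fin.mk_le_of_le_val (Nat.zero_le _))
  · rw [one_mul]
    exact hpv.trans (hv.1.monotone (Fin.le_def.2 (by omega)))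

/-- The total moving density offered to the outgoing road lies in `[0, 1]`: the second road
contributes only when the joint incoming flux is below the threshold `p ≤ v₂`. -/
theorem sum_deltaC_mem_Icc {n : ℕ} {hn : 2 ≤ n} {v : Fin n → ℝ} (hv : IsSpeedLattice hn v)
    {ε : ℝ} {H : ℝ → ℝ} (hH : IsRegularizer ε H) {p : ℝ} (hp0 : 0 < p)
    {i : Fin n} (hi : (i : ℕ) = 1) (hpv : p ≤ v i) {f g : Fin n → ℝ}
    (hf : admissibleF f) (hg : admissibleF g) :
    ∑ k, deltaC k * (f k + H (p - (fluxF v f + fluxF v g)) * g k) ∈ Icc (0:ℝ) 1 := by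
  obtain ⟨hH01, hH0, -, -⟩ := hH
  set h := H (p - (fluxF v f + fluxF v g))
  have h01 : h ∈ Icc (0:ℝ) 1 := hH01 _
  have hfg : ∀ k, 0 ≤ f k + h * g k := fun k =>
    add_nonneg (hf.1 k).1 (mul_nonneg h01.1 (hg.1 k).1)
  refine ⟨Finset.sum_nonneg fun k _ => mul_nonneg (deltaC_nonneg k) (hfg k), ?_⟩
  rcases le_or_gt p (fluxF v f + fluxF v g) with hle | hlt
  · have h0 : h = 0 := hH0 _ (by linarith)
    refine le_trans (Finset.sum_le_sum fun k _ => ?_) hf.2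
    rw [h0, zero_mul, add_zero]
    exact mul_le_of_le_one_left (hf.1 k).1 (deltaC_le_one k)
  · have hsum : (∑ k, deltaC k * (f k + h * g k)) * p ≤ fluxF v f + fluxF v g := by
      rw [Finset.sum_mul, fluxF, fluxF, ← Finset.sum_add_distrib]
      refine Finset.sum_le_sum fun k _ => ?_
      calc deltaC k * (f k + h * g k) * p = (deltaC k * p) * (f k + h * g k) := by ring
        _ ≤ (deltaC k * p) * (f k + g k) := by
          gcongr
          · exact mul_nonneg (deltaC_nonneg k) hp0.le
          · exact mul_le_of_le_one_left (hg.1 k).1 h01.2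
        _ ≤ v k * (f k + g k) := by
          gcongr
          · exact add_nonneg (hf.1 k).1 (hg.1 k).1
          · exact deltaC_mul_le_speed hv hi hpv k
        _ = v k * f k + v k * g k := by ring
    by_contra! hc
    nlinarith

section Operators

variable {E : Type*} [PseudoMetricSpace E] {I : Set ℝ} {S : Set E} {n : ℕ} {a : ℝ → E → Fin n → ℝ}

theorem UniformBddLipOn.rhoF (ha : ∀ j, UniformBddLipOn I S (fun s x => a s x j)) :
    UniformBddLipOn I S (fun s x => rhoF (a s x)) :=
  .sum _ ha

theorem UniformBddLipOn.fluxF (v : Fin n → ℝ)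
    (ha : ∀ j, UniformBddLipOn I S (fun s x => a s x j)) :
    UniformBddLipOn I S (fun s x => fluxF v (a s x)) :=
  .sum _ fun j => (UniformBddLipOn.const (v j)).mul (ha j)

theorem UniformBddLipOn.gainF_sub_loss (η0 : ℝ) {A : Fin n → Fin n → Fin n → ℝ → ℝ}
    (hA : IsTableOfGames A) (ha : ∀ j, UniformBddLipOn I S (fun s x => a s x j))
    (hadm : ∀ s ∈ I, ∀ x ∈ S, admissibleF (a s x)) (j : Fin n) {b : ℝ → E → ℝ}
    (hb : UniformBddLipOn I S b) :
    UniformBddLipOn I S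
      (fun s x => b s x + gainF η0 A j (a s x) - a s x j * lossF η0 (a s x)) := by
  have hρ := UniformBddLipOn.rhoF ha
  have hAρ : ∀ h k, UniformBddLipOn I S (fun s x => A h k j (_root_.rhoF (a s x))) := fun h k => by
    obtain ⟨K, hK, hlip⟩ := hA.2.2 h k j
    exact UniformBddLipOn.comp hK.le (hA.1 h k j) hlip hρ
      fun s hs x hx => rhoF_mem_Icc (hadm s hs x hx)
  have hgain : UniformBddLipOn I S (fun s x => gainF η0 A j (a s x)) :=
    ((const η0).mul hρ).mul (.sum _ fun h => .sum _ fun k => ((hAρ h k).mul (ha h)).mul (ha k))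
  have hloss : UniformBddLipOn I S (fun s x => lossF η0 (a s x)) := by
    simpa only [lossF, pow_two] using (const η0).mul (hρ.mul hρ)
  exact (hb.add hgain).sub ((ha j).mul hloss)

end Operators

/-- Uniqueness of the mild kinetic solution across the regularized 2-1 junction. -/
theorem uniqueness_two_one_junction
    {n : ℕ} (hn : 2 ≤ n) (v : Fin n → ℝ) (hv : IsSpeedLattice hn v)
    (η0 : ℝ) (hη0 : 0 < η0)
    (A : Fin n → Fin n → Fin n → ℝ → ℝ) (hA : IsTableOfGames A)
    (Φ : ℝ → ℝ → ℝ) (hΦ : IsFluxLimiter Φ)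
    (ε : ℝ) (hε : 0 < ε) (H : ℝ → ℝ) (hH : IsRegularizer ε H)
    (p : ℝ) (hp0 : 0 < p) (hpv : p ≤ v ⟨1, by omega⟩)
    (T : ℝ) (hT : 0 < T)
    (φ1 φ2 φ3 : Fin n → ℝ) (fbar1 fbar2 : ℝ → Fin n → ℝ) (Φbar3 : ℝ → ℝ)
    (hdata : GoodData21 T φ1 φ2 φ3 fbar1 fbar2 Φbar3)
    (f1 f2 f3 g1 g2 g3 : ℝ → Fin n → ℝ)
    (hF : IsMildSol21 v η0 A Φ H p T φ1 φ2 φ3 fbar1 fbar2 Φbar3 f1 f2 f3)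
    (hG : IsMildSol21 v η0 A Φ H p T φ1 φ2 φ3 fbar1 fbar2 Φbar3 g1 g2 g3) :
    ∀ t ∈ Icc (0:ℝ) T, f1 t = g1 t ∧ f2 t = g2 t ∧ f3 t = g3 t := by
  obtain ⟨-, -, -, hb1, hb1', hb2, hb2', hb3, hb3'⟩ := hdata
  obtain ⟨hΦ01, -, KΦ, hKΦ, hΦlip⟩ := hΦ
  have hHreg := hH
  obtain ⟨hH01, -, -, KH, hKH, hHlip⟩ := hHreg
  let E := (Fin n → ℝ) × (Fin n → ℝ) × (Fin n → ℝ)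
  let I : Set ℝ := Icc 0 T
  let S : Set E := {x | admissibleF x.1 ∧ admissibleF x.2.1 ∧ admissibleF x.2.2}
  have hx1 : ∀ j, UniformBddLipOn I S (fun _ x => x.1 j) := fun j =>
    .of_state ((LipschitzWith.eval j).comp LipschitzWith.prod_fst |>.weaken (by simp))
      fun x hx => hx.1.1 j
  have hx2 : ∀ j, UniformBddLipOn I S (fun _ x => x.2.1 j) := fun j =>
    .of_state ((LipschitzWith.eval j).comp
      (LipschitzWith.prod_fst.comp LipschitzWith.prod_snd) |>.weaken (by simp))
      fun x hx => hx.2.1.1 j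
  have hx3 : ∀ j, UniformBddLipOn I S (fun _ x => x.2.2 j) := fun j =>
    .of_state ((LipschitzWith.eval j).comp
      (LipschitzWith.prod_snd.comp LipschitzWith.prod_snd) |>.weaken (by simp))
      fun x hx => hx.2.2.1 j
  have hh : UniformBddLipOn I S
      (fun s x => hcoef v H p (fun _ => x.1) (fun _ => x.2.1) s) :=
    .comp (D := Set.univ) hKH.le (fun u _ => hH01 u) (fun u _ w _ => hHlip u w)
      ((UniformBddLipOn.const p).sub ((UniformBddLipOn.fluxF v hx1).add (.fluxF v hx2)))
      fun _ _ _ _ => Set.mem_univ _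
  have hφ : UniformBddLipOn I S
      (fun s x => phi301 v Φ H p (fun _ => x.1) (fun _ => x.2.1) (fun _ => x.2.2) s) :=
    .comp₂ hKΦ.le hΦ01 hΦlip
      (.sum _ fun k => (UniformBddLipOn.const (deltaC k)).mul ((hx1 k).add (hh.mul (hx2 k))))
      (.rhoF hx3) (fun s _ x hx => sum_deltaC_mem_Icc hv hH hp0 rfl hpv hx.1 hx.2.1)
      fun s _ x hx => rhoF_mem_Icc hx.2.2
  have hin : ∀ (fbar : ℝ → Fin n → ℝ) (a : ℝ → E → Fin n → ℝ), ContinuousOn fbar I →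
      (∀ t ∈ I, admissibleF (fbar t)) → (∀ j, UniformBddLipOn I S (fun s x => a s x j)) →
      (∀ s ∈ I, ∀ x ∈ S, admissibleF (a s x)) → ∀ j, UniformBddLipOn I S
        (fun s x => Φ (∑ k, fbar s k) (rhoF (a s x)) * fbar s j) := by
    intro fbar a hc hadm ha haadm j
    have hbar : ∀ k, UniformBddLipOn I S (fun s _ => fbar s k) := fun k =>
      .of_time (continuousOn_pi.1 hc k) fun s hs => (hadm s hs).1 k
    exact (UniformBddLipOn.comp₂ hKΦ.le hΦ01 hΦlip (.sum _ hbar) (.rhoF ha)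
      (fun s hs _ _ => rhoF_mem_Icc (hadm s hs))
      fun s hs x hx => rhoF_mem_Icc (haadm s hs x hx)).mul (hbar j)
  have hr1 : ∀ j, UniformBddLipOn I S (fun s x =>
      rhs21_1 v η0 A Φ H p fbar1 (fun _ => x.1) (fun _ => x.2.1) (fun _ => x.2.2) j s) := fun j =>
    .gainF_sub_loss η0 hA hx1 (fun _ _ _ hx => hx.1) j ((UniformBddLipOn.const (v j)).mul
      ((hin fbar1 _ hb1 hb1' hx1 (fun _ _ _ hx => hx.1) j).sub (hφ.mul (hx1 j))))
  have hr2 : ∀ j, UniformBddLipOn I S (fun s x =>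
      rhs21_2 v η0 A Φ H p fbar2 (fun _ => x.1) (fun _ => x.2.1) (fun _ => x.2.2) j s) := fun j =>
    .gainF_sub_loss η0 hA hx2 (fun _ _ _ hx => hx.2.1) j ((UniformBddLipOn.const (v j)).mul
      ((hin fbar2 _ hb2 hb2' hx2 (fun _ _ _ hx => hx.2.1) j).sub ((hh.mul hφ).mul (hx2 j))))
  have hr3 : ∀ j, UniformBddLipOn I S (fun s x =>
      rhs21_3 v η0 A Φ H p Φbar3 (fun _ => x.1) (fun _ => x.2.1) (fun _ => x.2.2) j s) := fun j =>
    .gainF_sub_loss η0 hA hx3 (fun _ _ _ hx => hx.2.2) j ((UniformBddLipOn.const (v j)).mul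
      (((hφ.mul ((hx1 j).add (hh.mul (hx2 j)))).mul (.const (deltaC j))).sub
        ((UniformBddLipOn.of_time hb3 hb3').mul (hx3 j))))
  let V : ℝ → E → E := fun s x =>
    (fun j => rhs21_1 v η0 A Φ H p fbar1 (fun _ => x.1) (fun _ => x.2.1) (fun _ => x.2.2) j s,
     fun j => rhs21_2 v η0 A Φ H p fbar2 (fun _ => x.1) (fun _ => x.2.1) (fun _ => x.2.2) j s,
     fun j => rhs21_3 v η0 A Φ H p Φbar3 (fun _ => x.1) (fun _ => x.2.1) (fun _ => x.2.2) j s)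
  obtain ⟨K1, hK1, hl1⟩ := UniformBddLipOn.exists_uniform_lipschitz hr1
  obtain ⟨K2, hK2, hl2⟩ := UniformBddLipOn.exists_uniform_lipschitz hr2
  obtain ⟨K3, hK3, hl3⟩ := UniformBddLipOn.exists_uniform_lipschitz hr3
  have hV : ∀ s ∈ Ico 0 T, LipschitzOnWith (K1 + K2 + K3).toNNReal (V s) S := by
    intro s hs
    have hsI : s ∈ I := Ico_subset_Icc_self hs
    refine LipschitzOnWith.of_dist_le_mul fun x hx y hy => ?_
    rw [Real.coe_toNNReal _ (by positivity)]
    have hd : 0 ≤ dist x y := dist_nonneg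
    have h0 : 0 ≤ (K1 + K2 + K3) * dist x y := by positivity
    refine max_le ?_ (max_le ?_ ?_) <;> refine (dist_pi_le_iff h0).2 fun j => ?_
    · exact (hl1 j s hsI x hx y hy).trans (by gcongr; linarith)
    · exact (hl2 j s hsI x hx y hy).trans (by gcongr; linarith)
    · exact (hl3 j s hsI x hx y hy).trans (by gcongr; linarith)
  have hsol : ∀ f1 f2 f3 : ℝ → Fin n → ℝ,
      IsMildSol21 v η0 A Φ H p T φ1 φ2 φ3 fbar1 fbar2 Φbar3 f1 f2 f3 →
      ContinuousOn (fun t => ((f1 t, f2 t, f3 t) : E)) (Icc 0 T) ∧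
      (∀ t ∈ Ico 0 T, HasDerivWithinAt (fun t => ((f1 t, f2 t, f3 t) : E))
        (V t (f1 t, f2 t, f3 t)) (Ici t) t) ∧
      (∀ t ∈ Ico 0 T, ((f1 t, f2 t, f3 t) : E) ∈ S) ∧
      ((f1 0, f2 0, f3 0) : E) = (φ1, φ2, φ3) := by
    rintro f1 f2 f3 ⟨hc1, hc2, hc3, hadm, he1, he2, he3⟩
    have hc : ContinuousOn (fun t => ((f1 t, f2 t, f3 t) : E)) I := hc1.prodMk (hc2.prodMk hc3)
    refine ⟨hc, fun t ht => ?_, fun t ht => hadm t (Ico_subset_Icc_self ht), ?_⟩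
    · refine (hasDerivWithinAt_pi.2 fun j => ?_).prodMk
        ((hasDerivWithinAt_pi.2 fun j => ?_).prodMk (hasDerivWithinAt_pi.2 fun j => ?_))
      · exact hasDerivWithinAt_Ici_of_eq_integral ((hr1 j).continuousOn_comp_curve hc hadm)
          (fun t ht => he1 t ht j) ht
      · exact hasDerivWithinAt_Ici_of_eq_integral ((hr2 j).continuousOn_comp_curve hc hadm)
          (fun t ht => he2 t ht j) ht
      · exact hasDerivWithinAt_Ici_of_eq_integral ((hr3 j).continuousOn_comp_curve hc hadm)
          (fun t ht => he3 t ht j) ht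
    · have h0 : (0:ℝ) ∈ Icc 0 T := ⟨le_rfl, hT.le⟩
      have e1 : f1 0 = φ1 := funext fun j => by simpa using he1 0 h0 j
      have e2 : f2 0 = φ2 := funext fun j => by simpa using he2 0 h0 j
      have e3 : f3 0 = φ3 := funext fun j => by simpa using he3 0 h0 j
      rw [e1, e2, e3]
  obtain ⟨hFc, hFd, hFS, hF0⟩ := hsol f1 f2 f3 hF
  obtain ⟨hGc, hGd, hGS, hG0⟩ := hsol g1 g2 g3 hG
  intro t ht
  have h := ODE_solution_unique_of_mem_Icc_right (s := fun _ => S) hV hFc hFd hFS hGc hGd hGS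
    (hF0.trans hG0.symm) ht
  exact ⟨congrArg Prod.fst h, congrArg (fun x => x.2.1) h, congrArg (fun x => x.2.2) h⟩
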